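/- Fix ρ ∈ (0,1), a 3-CNF formula φ with m ≥ 2 clauses over variables x_1,…,x_r, and an integer γ ≥ 1. Define instances (G_γ, H_γ, D_γ) recursively: (G_1,H_1,D_1) is the instance in which G_1 has vertices s_1, t_1 joined by m internally disjoint paths of three edges e_{i,1},e_{i,2},e_{i,3} (one path per clause i), H_1 consists of a commodity h_{i,j} across each edge e_{i,j} plus a commodity h_0 from s_1 to t_1, and D_1 = {d : ∃ ξ ∈ [0,1]^{literals}, ξ(x_k)+ξ(¬x_k)=1 ∀k, d_{h_{i,j}} = ξ(l_{i,j}) ∀i,j, 0 ≤ d_{h_0} ≤ m(1−ρ)}. For γ ≥ 2, G_γ is obtained from G_1 by replacing each edge e_{i,j} by a disjoint copy G^{i,j}_{γ−1} of G_{γ−1}, identifying the terminal s_{γ−1} of the copy with s(e_{i,j}) and t_{γ−1} with t(e_{i,j}); H_γ consists of all commodities of all copies together with one commodity h_{0,γ} between s_γ and t_γ; D_γ = {d : ∃ ξ ∈ [0,1]^{literals} with ξ(x_k)+ξ(¬x_k)=1 ∀k, such that for each i,j the demand subvector d^{i,j} of copy (i,j) lies in ξ(l_{i,j})·D_{γ−1},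 and 0 ≤ d_{h_{0,γ}} ≤ m^γ(1−ρ)}, where t·D = {t·d : d ∈ D}. Then G_γ has exactly 2 + 2m((3m)^γ − 1)/(3m − 1) vertices and maximum degree m^γ, and, with capacity 1 on every edge: if val(φ) = 1 then the minimum dynamic congestion of (G_γ,H_γ,D_γ) is at least 1 + γ(1−ρ), and if val(φ) < ρ then it is at most 1. -/

import Mathlib

open scoped BigOperators Pointwise

/-- Net flow out of vertex `v` for a single-commodity flow `f` on an undirected
graph whose edges `e` have endpoints `src e` and `dst e`; `f e true` is the flow
on `e` oriented from `src e` to `dst e`, `f e false` the flow on the opposite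
orientation. -/
def netOut {V E : Type*} [Fintype E] [DecidableEq V]
    (src dst : E → V) (f : E → Bool → ℝ) (v : V) : ℝ :=
  ∑ e, ((if src e = v then f e true - f e false else 0) +
        (if dst e = v then f e false - f e true else 0))

/-- `f` is a routing of the demand vector `d` under the reservation `u`:
each commodity flow is nonnegative, conserved at every vertex other than the
endpoints of the commodity, ships a net flow of `d h` out of `s h`, and the
total flow (in both directions) on each edge is at most `u e`. -/
def IsRouting {V E H : Type*} [Fintype E] [Fintype H] [DecidableEq V]
    (src dst : E → V) (s t : H → V) (d : H → ℝ) (u : E → ℝ)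
    (f : H → E → Bool → ℝ) : Prop :=
  (∀ h e b, 0 ≤ f h e b) ∧
  (∀ h v, v ≠ s h → v ≠ t h → netOut src dst (f h) v = 0) ∧
  (∀ h, netOut src dst (f h) (s h) = d h) ∧
  (∀ e, (∑ h, (f h e true + f h e false)) ≤ u e)

/-- `d` is routable under the reservation `u`. -/
def Routable {V E H : Type*} [Fintype E] [Fintype H] [DecidableEq V]
    (src dst : E → V) (s t : H → V) (d : H → ℝ) (u : E → ℝ) : Prop :=
  ∃ f, IsRouting src dst s t d u f


/-- The set of reservations under which every demand vector of `D` is routable. -/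
def Uset {V E H : Type*} [Fintype E] [Fintype H] [DecidableEq V]
    (src dst : E → V) (s t : H → V) (D : Set (H → ℝ)) : Set (E → ℝ) :=
  {u | (∀ e, 0 ≤ u e) ∧ ∀ d ∈ D, Routable src dst s t d u}

/-! ### The recursive instances `(G_γ, H_γ, D_γ)`

Throughout, the level-`n` objects correspond to the instance with `γ = n + 1`.
The 3-CNF formula over variables `x_1, …, x_r` with `m` clauses is encoded by
`lit : Fin m → Fin 3 → Fin r × Bool` where `lit i j = (k, b)` means that the
literal in position `j` of clause `i` is `x_k` if `b = true`, `¬x_k` otherwise;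
an assignment `a : Fin r → Bool` satisfies the literal `(k, b)` iff `a k = b`. -/

/-- Non-terminal vertices of `G_{n+1}`: at level `0` the two internal vertices
of each clause path, and at level `n+1` the internal vertices of the `3m`
copies of `G_{n+1}` together with the `2m` junction vertices. -/
def GapInner (m : ℕ) : ℕ → Type
  | 0 => Fin m × Fin 2
  | n+1 => (Fin m × Fin 3 × GapInner m n) ⊕ (Fin m × Fin 2)

/-- Vertices of `G_{n+1}`: `Sum.inl false` is the terminal `s`, `Sum.inl true`
is the terminal `t`, the rest are internal. -/
def GapVtx (m n : ℕ) : Type := Bool ⊕ GapInner m n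

/-- Edges of `G_{n+1}`: at level `n+1`, edge `(i, j, e)` is the edge `e` of the
copy `G^{i,j}` of `G_n` replacing the edge `e_{i,j}` of `G₁`. -/
def GapEdg (m : ℕ) : ℕ → Type
  | 0 => Fin m × Fin 3
  | n+1 => Fin m × Fin 3 × GapEdg m n

/-- Commodities of `G_{n+1}`: `none` is the top commodity `h_{0,γ}` between the
two terminals; `some (i, j, h)` is the commodity `h` of the copy `G^{i,j}`. -/
def GapCom (m : ℕ) : ℕ → Type
  | 0 => Option (Fin m × Fin 3)
  | n+1 => Option (Fin m × Fin 3 × GapCom m n)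

instance gapInnerFintype (m : ℕ) : ∀ n, Fintype (GapInner m n)
  | 0 => inferInstanceAs (Fintype (Fin m × Fin 2))
  | n+1 => haveI := gapInnerFintype m n
      inferInstanceAs (Fintype ((Fin m × Fin 3 × GapInner m n) ⊕ (Fin m × Fin 2)))

instance gapInnerDecEq (m : ℕ) : ∀ n, DecidableEq (GapInner m n)
  | 0 => inferInstanceAs (DecidableEq (Fin m × Fin 2))
  | n+1 => haveI := gapInnerDecEq m n
      inferInstanceAs (DecidableEq ((Fin m × Fin 3 × GapInner m n) ⊕ (Fin m × Fin 2)))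

instance (m n : ℕ) : Fintype (GapVtx m n) := inferInstanceAs (Fintype (Bool ⊕ GapInner m n))
instance (m n : ℕ) : DecidableEq (GapVtx m n) :=
  inferInstanceAs (DecidableEq (Bool ⊕ GapInner m n))

instance gapEdgFintype (m : ℕ) : ∀ n, Fintype (GapEdg m n)
  | 0 => inferInstanceAs (Fintype (Fin m × Fin 3))
  | n+1 => haveI := gapEdgFintype m n
      inferInstanceAs (Fintype (Fin m × Fin 3 × GapEdg m n))

instance gapEdgDecEq (m : ℕ) : ∀ n, DecidableEq (GapEdg m n)
  | 0 => inferInstanceAs (DecidableEq (Fin m × Fin 3))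
  | n+1 => haveI := gapEdgDecEq m n
      inferInstanceAs (DecidableEq (Fin m × Fin 3 × GapEdg m n))

instance gapComFintype (m : ℕ) : ∀ n, Fintype (GapCom m n)
  | 0 => inferInstanceAs (Fintype (Option (Fin m × Fin 3)))
  | n+1 => haveI := gapComFintype m n
      inferInstanceAs (Fintype (Option (Fin m × Fin 3 × GapCom m n)))

/-- Embedding of the vertices of the copy `G^{i,j}` of `G_n` into `G_{n+1}`:
the terminal `s` of the copy is identified with the global terminal `s` if
`j = 0` and with the junction vertex `(i, j-1)` otherwise; the terminal `t` of
the copy is identified with the global terminal `t` if `j = 2` and with the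
junction vertex `(i, j)` otherwise; internal vertices are kept disjoint. -/
def gapEmb (m n : ℕ) (i : Fin m) (j : Fin 3) : GapVtx m n → GapVtx m (n+1)
  | Sum.inl false => if _h : j.val = 0 then Sum.inl false
      else Sum.inr (Sum.inr (i, ⟨j.val - 1, by have := j.isLt; omega⟩))
  | Sum.inl true => if _h : j.val = 2 then Sum.inl true
      else Sum.inr (Sum.inr (i, ⟨j.val, by have := j.isLt; omega⟩))
  | Sum.inr w => Sum.inr (Sum.inl (i, j, w))

/-- Source vertex of an edge of `G_{n+1}`. -/
def gapSrcE (m : ℕ) : (n : ℕ) → GapEdg m n → GapVtx m n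
  | 0, e => if _h : e.2.val = 0 then Sum.inl false
      else Sum.inr (e.1, ⟨e.2.val - 1, by have := e.2.isLt; omega⟩)
  | n+1, e => gapEmb m n e.1 e.2.1 (gapSrcE m n e.2.2)

/-- Target vertex of an edge of `G_{n+1}`. -/
def gapDstE (m : ℕ) : (n : ℕ) → GapEdg m n → GapVtx m n
  | 0, e => if _h : e.2.val = 2 then Sum.inl true
      else Sum.inr (e.1, ⟨e.2.val, by have := e.2.isLt; omega⟩)
  | n+1, e => gapEmb m n e.1 e.2.1 (gapDstE m n e.2.2)

/-- Source endpoint of a commodity of `G_{n+1}`. -/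
def gapSrcC (m : ℕ) : (n : ℕ) → GapCom m n → GapVtx m n
  | 0, none => Sum.inl false
  | 0, some e => gapSrcE m 0 e
  | _n+1, none => Sum.inl false
  | n+1, some x => gapEmb m n x.1 x.2.1 (gapSrcC m n x.2.2)

/-- Target endpoint of a commodity of `G_{n+1}`. -/
def gapDstC (m : ℕ) : (n : ℕ) → GapCom m n → GapVtx m n
  | 0, none => Sum.inl true
  | 0, some e => gapDstE m 0 e
  | _n+1, none => Sum.inl true
  | n+1, some x => gapEmb m n x.1 x.2.1 (gapDstC m n x.2.2)

/-- The demand polytope `D_{n+1}`: at level `0`, the demands of the commodities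
`h_{i,j}` are given by fractional literal values `ξ` with
`ξ(x_k) + ξ(¬x_k) = 1` and `0 ≤ d_{h₀} ≤ m (1 - ρ)`; at level `n+1`, the demand
subvector of the copy `G^{i,j}` lies in `ξ(l_{i,j}) • D_n` and the top demand
satisfies `0 ≤ d_{h_{0,γ}} ≤ m^γ (1 - ρ)` (with `γ = n + 2`). -/
def GapD (m r : ℕ) (ρ : ℝ) (lit : Fin m → Fin 3 → Fin r × Bool) :
    (n : ℕ) → Set (GapCom m n → ℝ)
  | 0 => {d | ∃ ξ : Fin r × Bool → ℝ,
      (∀ l, 0 ≤ ξ l ∧ ξ l ≤ 1) ∧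
      (∀ k : Fin r, ξ (k, true) + ξ (k, false) = 1) ∧
      (∀ i j, d (some (i, j)) = ξ (lit i j)) ∧
      0 ≤ d none ∧ d none ≤ (m : ℝ) * (1 - ρ)}
  | n+1 => {d | ∃ ξ : Fin r × Bool → ℝ,
      (∀ l, 0 ≤ ξ l ∧ ξ l ≤ 1) ∧
      (∀ k : Fin r, ξ (k, true) + ξ (k, false) = 1) ∧
      (∀ i j, (fun c => d (some (i, j, c))) ∈ ξ (lit i j) • GapD m r ρ lit n) ∧
      0 ≤ d none ∧ d none ≤ (m : ℝ) ^ (n + 2) * (1 - ρ)}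

/-- Degree of a vertex: the number of incident edge-endpoints. -/
def gapDegree (m n : ℕ) (v : GapVtx m n) : ℕ :=
  (Finset.univ.filter (fun e : GapEdg m n => gapSrcE m n e = v)).card +
  (Finset.univ.filter (fun e : GapEdg m n => gapDstE m n e = v)).card


/-! ### Flows tested against potentials -/

section Flow

variable {V E H : Type*} [Fintype E]

/-- `φ` is a flow of value `d` from `s` to `t`, expressed by testing it against all potentials. -/
def IsFlow (src dst : E → V) (φ : E → Bool → ℝ) (s t : V) (d : ℝ) : Prop :=
  ∀ p : V → ℝ, ∑ e, (φ e true - φ e false) * (p (src e) - p (dst e)) = d * (p s - p t)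

theorem sum_mul_netOut [Fintype V] [DecidableEq V] (src dst : E → V) (φ : E → Bool → ℝ)
    (p : V → ℝ) :
    ∑ v, p v * netOut src dst φ v =
      ∑ e, (φ e true - φ e false) * (p (src e) - p (dst e)) := by
  simp only [netOut, Finset.mul_sum]
  rw [Finset.sum_comm]
  refine Finset.sum_congr rfl fun e _ => ?_
  simp only [mul_add, mul_ite, mul_zero, Finset.sum_add_distrib, Finset.sum_ite_eq,
    Finset.mem_univ, if_true]
  ring

theorem IsFlow.netOut_eq [Fintype V] [DecidableEq V] {src dst : E → V} {φ : E → Bool → ℝ}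
    {s t : V} {d : ℝ} (h : IsFlow src dst φ s t d) (v : V) :
    netOut src dst φ v = d * ((if s = v then 1 else 0) - (if t = v then 1 else 0)) := by
  refine Eq.trans ?_ (h fun w => if w = v then 1 else 0)
  refine Eq.trans ?_ (sum_mul_netOut src dst φ fun w => if w = v then 1 else 0)
  simp

theorem isFlow_of_netOut [Fintype V] [DecidableEq V] {src dst : E → V} {φ : E → Bool → ℝ}
    {s t : V} {d : ℝ} (h0 : ∀ v, v ≠ s → v ≠ t → netOut src dst φ v = 0)
    (hs : netOut src dst φ s = d) : IsFlow src dst φ s t d := by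
  intro p
  have h := sum_mul_netOut src dst φ fun v => p v - p t
  simp only [sub_sub_sub_cancel_right] at h
  rw [← h, Finset.sum_eq_single s, hs, mul_comm]
  · intro v _ hv
    by_cases hvt : v = t
    · simp [hvt]
    · rw [h0 v hv hvt, mul_zero]
  · simp

theorem IsFlow.mul_left {src dst : E → V} {φ : E → Bool → ℝ} {s t : V} {d : ℝ}
    (h : IsFlow src dst φ s t d) (c : ℝ) :
    IsFlow src dst (fun e b => c * φ e b) s t (c * d) := by
  intro p
  rw [mul_assoc, ← h p, Finset.mul_sum]
  exact Finset.sum_congr rfl fun e _ => by ring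

theorem routable_of_isFlow [Fintype V] [DecidableEq V] [Fintype H] {src dst : E → V}
    {s t : H → V} (hst : ∀ h, s h ≠ t h) {d : H → ℝ} {u : E → ℝ} {f : H → E → Bool → ℝ}
    (hf : ∀ h e b, 0 ≤ f h e b) (hflow : ∀ h, IsFlow src dst (f h) (s h) (t h) (d h))
    (hu : ∀ e, ∑ h, (f h e true + f h e false) ≤ u e) :
    Routable src dst s t d u := by
  refine ⟨f, hf, fun h v hs ht => ?_, fun h => ?_, hu⟩
  · rw [(hflow h).netOut_eq, if_neg hs.symm, if_neg ht.symm]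
    ring
  · rw [(hflow h).netOut_eq, if_pos rfl, if_neg (hst h).symm]
    ring

/-- Weak duality between routings and potentials. -/
theorem Routable.sum_demand_le [Fintype V] [DecidableEq V] [Fintype H] {src dst : E → V}
    {s t : H → V} {d : H → ℝ} {u : E → ℝ} (h : Routable src dst s t d u) (p : V → ℝ) :
    ∑ h, d h * (p (t h) - p (s h)) ≤ ∑ e, u e * |p (dst e) - p (src e)| := by
  obtain ⟨f, hf, h0, hs, hu⟩ := h
  calc ∑ h, d h * (p (t h) - p (s h))
      = ∑ h, ∑ e, (f h e true - f h e false) * (p (dst e) - p (src e)) := by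
        refine Finset.sum_congr rfl fun h _ => ?_
        have := isFlow_of_netOut (h0 h) (hs h) fun v => - p v
        simp only [neg_sub_neg] at this
        exact this.symm
    _ ≤ ∑ h, ∑ e, (f h e true + f h e false) * |p (dst e) - p (src e)| := by
        refine Finset.sum_le_sum fun h _ => Finset.sum_le_sum fun e _ => ?_
        refine (le_abs_self _).trans ?_
        rw [abs_mul]
        refine mul_le_mul_of_nonneg_right (abs_le.2 ⟨?_, ?_⟩) (abs_nonneg _) <;>
          linarith [hf h e true, hf h e false]
    _ = ∑ e, (∑ h, (f h e true + f h e false)) * |p (dst e) - p (src e)| := by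
        rw [Finset.sum_comm]
        simp only [Finset.sum_mul]
    _ ≤ _ := Finset.sum_le_sum fun e _ => mul_le_mul_of_nonneg_right (hu e) (abs_nonneg _)

end Flow

/-! ### Structure of the recursive graphs -/

theorem sum_gapEdg_zero {M : Type*} [AddCommMonoid M] (m : ℕ) (F : GapEdg m 0 → M) :
    ∑ e, F e = ∑ i : Fin m, ∑ j : Fin 3, F (i, j) :=
  Fintype.sum_prod_type (α₁ := Fin m) (α₂ := Fin 3) F

theorem sum_gapEdg_succ {M : Type*} [AddCommMonoid M] (m n : ℕ) (F : GapEdg m (n + 1) → M) :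
    ∑ e, F e = ∑ i : Fin m, ∑ j : Fin 3, ∑ e : GapEdg m n, F (i, j, e) :=
  (Fintype.sum_prod_type (α₁ := Fin m) (α₂ := Fin 3 × GapEdg m n) F).trans
    (Finset.sum_congr rfl fun _ _ => Fintype.sum_prod_type _)

theorem sum_gapCom_zero {M : Type*} [AddCommMonoid M] (m : ℕ) (F : GapCom m 0 → M) :
    ∑ c, F c = F none + ∑ i : Fin m, ∑ j : Fin 3, F (some (i, j)) :=
  (Fintype.sum_option (α := Fin m × Fin 3) F).trans
    (congrArg _ (Fintype.sum_prod_type _))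

theorem sum_gapCom_succ {M : Type*} [AddCommMonoid M] (m n : ℕ) (F : GapCom m (n + 1) → M) :
    ∑ c, F c = F none + ∑ i : Fin m, ∑ j : Fin 3, ∑ c : GapCom m n, F (some (i, j, c)) :=
  (Fintype.sum_option (α := Fin m × Fin 3 × GapCom m n) F).trans
    (congrArg _ ((Fintype.sum_prod_type _).trans
      (Finset.sum_congr rfl fun _ _ => Fintype.sum_prod_type _)))

theorem card_gapInner_zero (m : ℕ) : Fintype.card (GapInner m 0) = m * 2 :=
  (Fintype.card_prod (Fin m) (Fin 2)).trans (by simp)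

theorem card_gapInner_succ (m n : ℕ) :
    Fintype.card (GapInner m (n + 1)) = m * (3 * Fintype.card (GapInner m n)) + m * 2 :=
  (Fintype.card_sum (α := Fin m × Fin 3 × GapInner m n) (β := Fin m × Fin 2)).trans (by simp)

theorem card_gapInner (m n : ℕ) :
    Fintype.card (GapInner m n) = 2 * m * ∑ k ∈ Finset.range (n + 1), (3 * m) ^ k := by
  induction n with
  | zero => rw [card_gapInner_zero]; simp [mul_comm]
  | succ n ih => rw [card_gapInner_succ, ih, geom_sum_succ (n := n + 1)]; ring

theorem card_gapVtx (m n : ℕ) :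
    Fintype.card (GapVtx m n) = 2 + Fintype.card (GapInner m n) :=
  (Fintype.card_sum (α := Bool) (β := GapInner m n)).trans (by simp)

theorem gapEmb_injective (m n : ℕ) (i : Fin m) (j : Fin 3) :
    Function.Injective (gapEmb m n i j) := by
  rintro ((_ | _) | v) ((_ | _) | w) h <;> fin_cases j <;>
    simp_all [gapEmb, GapVtx, GapInner]

theorem gapSrcC_ne_gapDstC (m : ℕ) : ∀ (n : ℕ) (c : GapCom m n), gapSrcC m n c ≠ gapDstC m n c
  | 0, none => Sum.inl_injective.ne Bool.false_ne_true
  | 0, some (i, j) => by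
    fin_cases j <;> simp [gapSrcC, gapDstC, gapSrcE, gapDstE, GapVtx, GapInner]
  | _ + 1, none => Sum.inl_injective.ne Bool.false_ne_true
  | n + 1, some (i, j, c) => (gapEmb_injective m n i j).ne (gapSrcC_ne_gapDstC m n c)

theorem sum_gapE_zero_telescope (m : ℕ) (i : Fin m) (p : GapVtx m 0 → ℝ) :
    ∑ j : Fin 3, (p (gapSrcE m 0 (i, j)) - p (gapDstE m 0 (i, j))) =
      p (Sum.inl false) - p (Sum.inl true) := by
  simp [Fin.sum_univ_three, gapSrcE, gapDstE]
  ring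

theorem sum_gapEmb_telescope (m n : ℕ) (i : Fin m) (p : GapVtx m (n + 1) → ℝ) :
    ∑ j : Fin 3, (p (gapEmb m n i j (Sum.inl false)) - p (gapEmb m n i j (Sum.inl true))) =
      p (Sum.inl false) - p (Sum.inl true) := by
  simp [Fin.sum_univ_three, gapEmb]
  ring

/-- Sending one unit along every edge is a flow of value `m ^ (n + 1)`. -/
theorem sum_gap_potential_diff (m n : ℕ) (p : GapVtx m n → ℝ) :
    ∑ e, (p (gapSrcE m n e) - p (gapDstE m n e)) =
      (m : ℝ) ^ (n + 1) * (p (Sum.inl false) - p (Sum.inl true)) := by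
  induction n with
  | zero =>
    rw [sum_gapEdg_zero]
    simp only [sum_gapE_zero_telescope]
    simp [mul_sub]
  | succ n ih =>
    rw [sum_gapEdg_succ]
    have h (i : Fin m) (j : Fin 3) := ih fun v => p (gapEmb m n i j v)
    simp only [gapSrcE, gapDstE, h, ← Finset.mul_sum, sum_gapEmb_telescope]
    simp
    ring

/-! ### Degrees -/

/-- The terminal `s` of `G_{n+1}`. -/
def gapSource (m n : ℕ) : GapVtx m n := Sum.inl false

/-- The terminal `t` of `G_{n+1}`. -/
def gapTarget (m n : ℕ) : GapVtx m n := Sum.inl true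

/-- An internal vertex of `G_{n+1}`. -/
def gapInternal {m n : ℕ} (w : GapInner m n) : GapVtx m n := Sum.inr w

/-- An internal vertex of the copy `G^{i,j}` of `G_{n+1}` inside `G_{n+2}`. -/
def gapCopyInternal {m n : ℕ} (i : Fin m) (j : Fin 3) (w : GapInner m n) : GapVtx m (n + 1) :=
  Sum.inr (Sum.inl (i, j, w))

/-- A junction vertex of `G_{n+2}`. -/
def gapJunction {m : ℕ} (n : ℕ) (i : Fin m) (k : Fin 2) : GapVtx m (n + 1) :=
  Sum.inr (Sum.inr (i, k))

theorem gapDegree_eq_sum (m n : ℕ) (v : GapVtx m n) :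
    gapDegree m n v =
      ∑ e, ((if gapSrcE m n e = v then 1 else 0) + (if gapDstE m n e = v then 1 else 0)) := by
  rw [gapDegree, Finset.card_filter, Finset.card_filter, Finset.sum_add_distrib]

theorem gapDegree_succ (m n : ℕ) (v : GapVtx m (n + 1)) :
    gapDegree m (n + 1) v = ∑ i : Fin m, ∑ j : Fin 3, ∑ e : GapEdg m n,
      ((if gapEmb m n i j (gapSrcE m n e) = v then 1 else 0) +
        (if gapEmb m n i j (gapDstE m n e) = v then 1 else 0)) := by
  rw [gapDegree_eq_sum, sum_gapEdg_succ]
  rfl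

theorem gapEmb_eq_source {m n : ℕ} (i : Fin m) (j : Fin 3) (w : GapVtx m n) :
    gapEmb m n i j w = gapSource m (n + 1) ↔ j = 0 ∧ w = gapSource m n := by
  rcases w with ((_ | _) | w) <;> fin_cases j <;> simp [gapEmb, gapSource, GapVtx, GapInner]

theorem gapEmb_eq_target {m n : ℕ} (i : Fin m) (j : Fin 3) (w : GapVtx m n) :
    gapEmb m n i j w = gapTarget m (n + 1) ↔ j = 2 ∧ w = gapTarget m n := by
  rcases w with ((_ | _) | w) <;> fin_cases j <;> simp [gapEmb, gapTarget, GapVtx, GapInner]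

theorem gapEmb_eq_inner {m n : ℕ} (i i' : Fin m) (j j' : Fin 3) (w : GapVtx m n)
    (w' : GapInner m n) :
    gapEmb m n i j w = gapCopyInternal i' j' w' ↔ i = i' ∧ j = j' ∧ w = gapInternal w' := by
  rcases w with ((_ | _) | w) <;> fin_cases j <;>
    simp [gapEmb, gapInternal, gapCopyInternal, GapVtx, GapInner]

theorem gapEmb_eq_junction {m n : ℕ} (i i' : Fin m) (j : Fin 3) (k : Fin 2) (w : GapVtx m n) :
    gapEmb m n i j w = gapJunction n i' k ↔
      i = i' ∧ (j = k.succ ∧ w = gapSource m n ∨ j = k.castSucc ∧ w = gapTarget m n) := by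
  rcases w with ((_ | _) | w) <;> fin_cases j <;> fin_cases k <;>
    simp [gapEmb, gapSource, gapTarget, gapJunction, GapVtx, GapInner]

theorem gapDegree_source (m n : ℕ) : gapDegree m n (gapSource m n) = m ^ (n + 1) := by
  induction n with
  | zero =>
    refine (gapDegree_eq_sum m 0 _).trans ?_
    rw [sum_gapEdg_zero]
    simp [Fin.sum_univ_three, gapSrcE, gapDstE, gapSource, GapVtx, GapInner]
  | succ n ih =>
    refine (gapDegree_succ m n _).trans ?_
    simp only [gapEmb_eq_source, Fin.sum_univ_three]
    simp [← gapDegree_eq_sum, ih, pow_succ']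

theorem gapDegree_target (m n : ℕ) : gapDegree m n (gapTarget m n) = m ^ (n + 1) := by
  induction n with
  | zero =>
    refine (gapDegree_eq_sum m 0 _).trans ?_
    rw [sum_gapEdg_zero]
    simp [Fin.sum_univ_three, gapSrcE, gapDstE, gapTarget, GapVtx, GapInner]
  | succ n ih =>
    refine (gapDegree_succ m n _).trans ?_
    simp only [gapEmb_eq_target, Fin.sum_univ_three]
    simp [← gapDegree_eq_sum, ih, pow_succ']

theorem gapDegree_inner {m n : ℕ} (i : Fin m) (j : Fin 3) (w : GapInner m n) :
    gapDegree m (n + 1) (gapCopyInternal i j w) = gapDegree m n (gapInternal w) := by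
  refine (gapDegree_succ m n _).trans ?_
  rw [Finset.sum_eq_single i, Finset.sum_eq_single j]
  · simp only [gapEmb_eq_inner, true_and]
    exact (gapDegree_eq_sum m n _).symm
  · intro j' _ hj
    simp only [gapEmb_eq_inner, hj, false_and, and_false]
    simp
  · simp
  · intro i' _ hi
    simp only [gapEmb_eq_inner, hi, false_and]
    simp
  · simp

theorem gapDegree_junction {m n : ℕ} (i : Fin m) (k : Fin 2) :
    gapDegree m (n + 1) (gapJunction n i k) = 2 * m ^ (n + 1) := by
  refine (gapDegree_succ m n _).trans ?_
  rw [Finset.sum_eq_single i, two_mul]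
  · simp only [gapEmb_eq_junction, true_and, Fin.sum_univ_three]
    fin_cases k <;>
      simp [← gapDegree_eq_sum, gapDegree_source, gapDegree_target]
  · intro i' _ hi
    simp only [gapEmb_eq_junction, hi, false_and]
    simp
  · simp

theorem gapDegree_le {m : ℕ} (hm : 2 ≤ m) :
    ∀ (n : ℕ) (v : GapVtx m n), gapDegree m n v ≤ m ^ (n + 1)
  | n, Sum.inl false => (gapDegree_source m n).le
  | n, Sum.inl true => (gapDegree_target m n).le
  | 0, Sum.inr w => by
    obtain ⟨i, k⟩ : Fin m × Fin 2 := w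
    refine (gapDegree_eq_sum m 0 _).trans_le ?_
    rw [sum_gapEdg_zero, Finset.sum_eq_single i]
    · fin_cases k <;>
        simpa [Fin.sum_univ_three, gapSrcE, gapDstE, GapVtx, GapInner] using hm
    · intro i' _ hi
      simp [Fin.sum_univ_three, gapSrcE, gapDstE, GapVtx, GapInner, hi]
    · simp
  | n + 1, Sum.inr (Sum.inl (i, j, w)) => by
    exact (gapDegree_inner i j w).trans_le <|
      (gapDegree_le hm n _).trans (Nat.pow_le_pow_right (by omega) (by omega))
  | n + 1, Sum.inr (Sum.inr (i, k)) => by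
    refine (gapDegree_junction i k).trans_le ?_
    rw [pow_succ' m (n + 1)]
    exact Nat.mul_le_mul_right _ hm

theorem sup_gapDegree {m : ℕ} (hm : 2 ≤ m) (n : ℕ) :
    Finset.univ.sup (gapDegree m n) = m ^ (n + 1) :=
  le_antisymm (Finset.sup_le fun v _ => gapDegree_le hm n v)
    ((gapDegree_source m n).symm.le.trans (Finset.le_sup (Finset.mem_univ _)))

/-! ### The cut selected by a choice of literals -/

section Cut

variable {m : ℕ} (sel : Fin m → Fin 3)

/-- The indicator of the sink side of the cut that crosses, at every level of the recursion, the
copies in position `(i, sel i)`. -/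
def gapCut : (n : ℕ) → GapVtx m n → ℝ
  | 0 => Sum.elim (fun b => if b then 1 else 0)
      fun x => if (sel x.1).val ≤ x.2.val then 1 else 0
  | n + 1 => Sum.elim (fun b => if b then 1 else 0) <| Sum.elim
      (fun x => if x.2.1 = sel x.1 then gapCut n (Sum.inr x.2.2)
        else if x.2.1 < sel x.1 then 0 else 1)
      fun x => if (sel x.1).val ≤ x.2.val then 1 else 0

theorem gapCut_source : ∀ n, gapCut sel n (Sum.inl false) = 0
  | 0 => rfl
  | _ + 1 => rfl

theorem gapCut_target : ∀ n, gapCut sel n (Sum.inl true) = 1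
  | 0 => rfl
  | _ + 1 => rfl

theorem gapCut_inner_zero (i : Fin m) (k : Fin 2) :
    gapCut sel 0 (Sum.inr (i, k)) = if (sel i).val ≤ k.val then 1 else 0 :=
  rfl

theorem gapCut_junction (n : ℕ) (i : Fin m) (k : Fin 2) :
    gapCut sel (n + 1) (Sum.inr (Sum.inr (i, k))) = if (sel i).val ≤ k.val then 1 else 0 :=
  rfl

theorem gapCut_gapEmb (n : ℕ) (i : Fin m) (j : Fin 3) (w : GapVtx m n) :
    gapCut sel (n + 1) (gapEmb m n i j w) =
      if j = sel i then gapCut sel n w else if j < sel i then 0 else 1 := by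
  have hs := gapCut_source sel n
  have ht := gapCut_target sel n
  rcases w with ((_ | _) | w)
  · rw [hs]
    generalize hk : sel i = k
    fin_cases j <;> fin_cases k <;>
      simp [gapEmb, gapCut_source, gapCut_junction, hk]
  · rw [ht]
    generalize hk : sel i = k
    fin_cases j <;> fin_cases k <;>
      simp [gapEmb, gapCut_target, gapCut_junction, hk]
  · rfl

theorem gapCut_zero_sub (i : Fin m) (j : Fin 3) :
    gapCut sel 0 (gapDstE m 0 (i, j)) - gapCut sel 0 (gapSrcE m 0 (i, j)) =
      if j = sel i then 1 else 0 := by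
  generalize hk : sel i = k
  fin_cases j <;> fin_cases k <;>
    simp [gapSrcE, gapDstE, gapCut_source, gapCut_target, gapCut_inner_zero, hk]

theorem gapCut_gapSrcE_le (n : ℕ) (e : GapEdg m n) :
    gapCut sel n (gapSrcE m n e) ≤ gapCut sel n (gapDstE m n e) := by
  induction n with
  | zero =>
    rw [← sub_nonneg, show e = (e.1, e.2) from rfl, gapCut_zero_sub]
    split_ifs <;> norm_num
  | succ n ih =>
    simp only [gapSrcE, gapDstE, gapCut_gapEmb]
    split_ifs
    · exact ih _
    · exact le_rfl
    · exact le_rfl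

theorem sum_abs_gapCut (n : ℕ) :
    ∑ e, |gapCut sel n (gapDstE m n e) - gapCut sel n (gapSrcE m n e)| = (m : ℝ) ^ (n + 1) := by
  have h := sum_gap_potential_diff m n fun v => - gapCut sel n v
  simp only [neg_sub_neg, gapCut_source, gapCut_target, sub_zero, mul_one] at h
  rw [← h]
  exact Finset.sum_congr rfl fun e _ => abs_of_nonneg (sub_nonneg.2 (gapCut_gapSrcE_le sel n e))

/-- If `sel` picks a literal satisfied by `a` in every clause, some demand vector loads the cut
with `m ^ (n + 1) * (1 + (n + 1) * (1 - ρ))` units. -/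
theorem exists_demand_across_gapCut {r : ℕ} {ρ : ℝ} (hρ : ρ ≤ 1)
    {lit : Fin m → Fin 3 → Fin r × Bool} {a : Fin r → Bool}
    (hsel : ∀ i, a (lit i (sel i)).1 = (lit i (sel i)).2) (n : ℕ) :
    ∃ d ∈ GapD m r ρ lit n,
      ∑ c, d c * (gapCut sel n (gapDstC m n c) - gapCut sel n (gapSrcC m n c)) =
        (m : ℝ) ^ (n + 1) * (1 + (n + 1 : ℕ) * (1 - ρ)) := by
  have hρ' : 0 ≤ 1 - ρ := sub_nonneg.2 hρ
  let ξ : Fin r × Bool → ℝ := fun l => if a l.1 = l.2 then 1 else 0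
  have hξ01 (l) : 0 ≤ ξ l ∧ ξ l ≤ 1 := by
    dsimp only [ξ]
    split_ifs <;> norm_num
  have hξadd (k) : ξ (k, true) + ξ (k, false) = 1 := by
    cases h : a k <;> simp [ξ, h]
  have hξsel (i) : ξ (lit i (sel i)) = 1 := if_pos (hsel i)
  induction n with
  | zero =>
    refine ⟨fun c => Option.elim c (m * (1 - ρ)) fun x => ξ (lit x.1 x.2),
      ⟨ξ, hξ01, hξadd, fun _ _ => rfl, mul_nonneg (by positivity) hρ', le_rfl⟩, ?_⟩
    rw [sum_gapCom_zero]
    simp only [Option.elim, gapSrcC, gapDstC, gapCut_source, gapCut_target, gapCut_zero_sub]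
    simp [hξsel]
    ring
  | succ n ih =>
    obtain ⟨d, hd, hsum⟩ := ih
    refine ⟨fun c => Option.elim c ((m : ℝ) ^ (n + 2) * (1 - ρ))
      fun x => ξ (lit x.1 x.2.1) * d x.2.2,
      ⟨ξ, hξ01, hξadd, fun i j => ⟨d, hd, rfl⟩, mul_nonneg (by positivity) hρ', le_rfl⟩, ?_⟩
    rw [sum_gapCom_succ]
    have key (i : Fin m) (j : Fin 3) :
        ∑ c : GapCom m n, ξ (lit i j) * d c *
          (gapCut sel (n + 1) (gapEmb m n i j (gapDstC m n c)) -
            gapCut sel (n + 1) (gapEmb m n i j (gapSrcC m n c))) =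
        if j = sel i then (m : ℝ) ^ (n + 1) * (1 + (n + 1 : ℕ) * (1 - ρ)) else 0 := by
      simp only [gapCut_gapEmb]
      split_ifs with h
      · subst h
        simp only [hξsel, one_mul, hsum]
      · simp
      · simp
    simp only [Option.elim, gapSrcC, gapDstC, gapCut_source, gapCut_target, key]
    simp
    ring

theorem le_iSup_of_mem_Uset {r : ℕ} {ρ : ℝ} (hρ : ρ ≤ 1) (hm : 0 < m)
    {lit : Fin m → Fin 3 → Fin r × Bool} {a : Fin r → Bool}
    (hsat : ∀ i, ∃ j, a (lit i j).1 = (lit i j).2) (n : ℕ) {u : GapEdg m n → ℝ}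
    (hu : u ∈ Uset (gapSrcE m n) (gapDstE m n) (gapSrcC m n) (gapDstC m n)
      (GapD m r ρ lit n)) :
    1 + (n + 1 : ℕ) * (1 - ρ) ≤ ⨆ e, u e := by
  choose sel hsel using hsat
  obtain ⟨d, hd, hsum⟩ := exists_demand_across_gapCut sel hρ hsel n
  have h := (hu.2 d hd).sum_demand_le (gapCut sel n)
  rw [hsum] at h
  refine le_of_mul_le_mul_left (h.trans ?_) (by positivity : (0 : ℝ) < (m : ℝ) ^ (n + 1))
  rw [← sum_abs_gapCut sel n, Finset.sum_mul]
  refine Finset.sum_le_sum fun e _ => ?_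
  rw [mul_comm]
  exact mul_le_mul_of_nonneg_left (le_ciSup (Set.finite_range u).bddAbove e) (abs_nonneg _)

end Cut

/-! ### Routing when few clauses can be satisfied simultaneously -/

section Routing

variable {m r : ℕ} {ρ : ℝ} {lit : Fin m → Fin 3 → Fin r × Bool}

/-- The value of a literal under a fractional assignment. -/
def litVal (x : Fin r → ℝ) (l : Fin r × Bool) : ℝ :=
  if l.2 then x l.1 else 1 - x l.1

/-- The fractional value of a clause. -/
def clauseVal (x : Fin r → ℝ) (c : Fin 3 → Fin r × Bool) : ℝ :=
  max (max (litVal x (c 0)) (litVal x (c 1))) (litVal x (c 2))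

theorem convexOn_litVal (l : Fin r × Bool) :
    ConvexOn ℝ Set.univ fun x : Fin r → ℝ => litVal x l := by
  refine ⟨convex_univ, fun x _ y _ a b _ _ hab => le_of_eq ?_⟩
  simp only [litVal, Pi.add_apply, Pi.smul_apply, smul_eq_mul]
  split_ifs
  · rfl
  · linear_combination -hab

theorem convexOn_sum_clauseVal (lit : Fin m → Fin 3 → Fin r × Bool) :
    ConvexOn ℝ Set.univ fun x : Fin r → ℝ => ∑ i, clauseVal x (lit i) := by
  have h (s : Finset (Fin m)) :
      ConvexOn ℝ Set.univ fun x : Fin r → ℝ => ∑ i ∈ s, clauseVal x (lit i) := by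
    induction s using Finset.induction_on with
    | empty => simpa using convexOn_const (0 : ℝ) convex_univ
    | insert i s hi ih =>
      simp only [Finset.sum_insert hi]
      exact (((convexOn_litVal _).sup (convexOn_litVal _)).sup (convexOn_litVal _)).add ih
  exact h _

/-- A fractional assignment cannot beat every Boolean one, by convexity. -/
theorem sum_clauseVal_le {B : ℝ}
    (hB : ∀ a : Fin r → Bool,
      ((Finset.univ.filter fun i => ∃ j, a (lit i j).1 = (lit i j).2).card : ℝ) ≤ B)
    {x : Fin r → ℝ} (hx : ∀ k, x k ∈ Set.Icc (0 : ℝ) 1) :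
    ∑ i, clauseVal x (lit i) ≤ B := by
  have hmem : x ∈ convexHull ℝ (Set.univ.pi fun _ : Fin r => ({0, 1} : Set ℝ)) := by
    rw [convexHull_pi]
    intro k _
    rw [convexHull_pair, segment_eq_Icc zero_le_one]
    exact hx k
  obtain ⟨y, hy, hxy⟩ := ((convexOn_sum_clauseVal lit).subset (Set.subset_univ _)
    (convex_convexHull ℝ _)).exists_ge_of_mem_convexHull (subset_convexHull ℝ _) hmem
  refine hxy.trans (le_trans ?_ (hB fun k => decide (y k = 1)))
  rw [Finset.card_filter, Nat.cast_sum]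
  refine Finset.sum_le_sum fun i _ => ?_
  have hlit (l : Fin r × Bool) :
      litVal y l = if decide (y l.1 = 1) = l.2 then 1 else 0 := by
    obtain ⟨k, b⟩ := l
    rcases hy k trivial with h | h <;> cases b <;> simp_all [litVal]
  have hle (j : Fin 3) : litVal y (lit i j) ≤
      ((if ∃ j, decide (y (lit i j).1 = 1) = (lit i j).2 then 1 else 0 : ℕ) : ℝ) := by
    rw [hlit]
    split_ifs with h1 h2
    · simp
    · exact absurd ⟨j, h1⟩ h2
    · simp
    · simp
  exact max_le (max_le (hle 0) (hle 1)) (hle 2)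

/-- The residual capacities along the clause paths can carry any demand up to `m * (1 - ρ)`. -/
theorem exists_path_flows
    (hval : ∀ a : Fin r → Bool,
      ((Finset.univ.filter fun i => ∃ j, a (lit i j).1 = (lit i j).2).card : ℝ) ≤ ρ * m)
    {ξ : Fin r × Bool → ℝ} (hξ : ∀ l, 0 ≤ ξ l ∧ ξ l ≤ 1)
    (hξadd : ∀ k, ξ (k, true) + ξ (k, false) = 1) {D : ℝ} (hD0 : 0 ≤ D)
    (hD : D ≤ m * (1 - ρ)) :
    ∃ β : Fin m → ℝ, (∀ i, 0 ≤ β i) ∧ (∀ i j, ξ (lit i j) + β i ≤ 1) ∧ ∑ i, β i = D := by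
  have hlit (l) : litVal (fun k => ξ (k, true)) l = ξ l := by
    obtain ⟨k, _ | _⟩ := l
    · simp only [litVal, Bool.false_eq_true, if_false]
      linarith [hξadd k]
    · rfl
  set M : Fin m → ℝ := fun i => clauseVal (fun k => ξ (k, true)) (lit i) with hM
  have hM1 (i) : 0 ≤ 1 - M i := by
    simp [hM, clauseVal, hlit, hξ]
  have hMj (i j) : ξ (lit i j) ≤ M i := by
    fin_cases j <;> simp [hM, clauseVal, hlit]
  have hsum : D ≤ ∑ i, (1 - M i) := by
    have := sum_clauseVal_le hval (x := fun k => ξ (k, true)) fun k => hξ _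
    rw [Finset.sum_sub_distrib]
    simp only [Finset.sum_const, Finset.card_univ, Fintype.card_fin, nsmul_eq_mul, mul_one]
    linarith
  set S := ∑ i, (1 - M i) with hS
  rcases eq_or_lt_of_le (hD0.trans hsum) with h0 | hpos
  · refine ⟨0, fun _ => le_rfl, fun i j => ?_, ?_⟩
    · simpa using (hξ (lit i j)).2
    · simp only [Pi.zero_apply, Finset.sum_const_zero]
      linarith
  · refine ⟨fun i => D / S * (1 - M i), fun i => mul_nonneg (by positivity) (hM1 i),
      fun i j => ?_, ?_⟩
    · have := mul_le_of_le_one_left (hM1 i) ((div_le_one hpos).2 hsum)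
      linarith [hMj i j]
    · rw [← Finset.mul_sum, ← hS, div_mul_cancel₀ _ hpos.ne']

theorem exists_unit_routing (hm : 0 < m)
    (hval : ∀ a : Fin r → Bool,
      ((Finset.univ.filter fun i => ∃ j, a (lit i j).1 = (lit i j).2).card : ℝ) ≤ ρ * m)
    (n : ℕ) : ∀ d ∈ GapD m r ρ lit n, ∃ f : GapCom m n → GapEdg m n → Bool → ℝ,
      (∀ c e b, 0 ≤ f c e b) ∧
      (∀ c, IsFlow (gapSrcE m n) (gapDstE m n) (f c) (gapSrcC m n c) (gapDstC m n c) (d c)) ∧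
      ∀ e, ∑ c, (f c e true + f c e false) ≤ 1 := by
  induction n with
  | zero =>
    rintro d ⟨ξ, hξ, hξadd, hd, h0, h1⟩
    obtain ⟨β, hβ0, hβ, hβsum⟩ := exists_path_flows hval hξ hξadd h0 h1
    refine ⟨fun c e b => Option.elim c (if b then β e.1 else 0)
      fun x => if x.1 = e.1 ∧ x.2 = e.2 then if b then ξ (lit e.1 e.2) else 0 else 0, ?_, ?_, ?_⟩
    · rintro (_ | x) e b
      · dsimp only [Option.elim]
        split_ifs
        exacts [hβ0 _, le_rfl]
      · dsimp only [Option.elim]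
        split_ifs
        exacts [(hξ _).1, le_rfl, le_rfl]
    · rintro (_ | ⟨i, j⟩) p
      · rw [sum_gapEdg_zero]
        simp only [Option.elim, if_true, Bool.false_eq_true, if_false, sub_zero,
          ← Finset.mul_sum, sum_gapE_zero_telescope, gapSrcC, gapDstC]
        rw [← Finset.sum_mul, hβsum]
      · rw [sum_gapEdg_zero, Finset.sum_eq_single i, Finset.sum_eq_single j]
        · simp [gapSrcC, gapDstC, hd]
        · intro j' _ hj
          simp [hj.symm]
        · simp
        · intro i' _ hi
          simp [hi.symm]
        · simp
    · rintro ⟨i, j⟩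
      rw [sum_gapCom_zero, Finset.sum_eq_single i, Finset.sum_eq_single j]
      · simpa [add_comm] using hβ i j
      · intro j' _ hj
        simp [hj]
      · simp
      · intro i' _ hi
        simp [hi]
      · simp
  | succ n ih =>
    rintro d ⟨ξ, hξ, hξadd, hd, h0, h1⟩
    have hmn : (0 : ℝ) < (m : ℝ) ^ (n + 1) := by positivity
    obtain ⟨β, hβ0, hβ, hβsum⟩ := exists_path_flows (D := d none / (m : ℝ) ^ (n + 1)) hval hξ
      hξadd (by positivity) (by rw [div_le_iff₀ hmn]; exact h1.trans (by rw [pow_succ]; linarith))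
    have hcopy (i : Fin m) (j : Fin 3) : ∃ f : GapCom m n → GapEdg m n → Bool → ℝ,
        (∀ c e b, 0 ≤ f c e b) ∧
        (∀ c, IsFlow (gapSrcE m n) (gapDstE m n) (f c) (gapSrcC m n c) (gapDstC m n c)
          (d (some (i, j, c)))) ∧
        ∀ e, ∑ c, (f c e true + f c e false) ≤ ξ (lit i j) := by
      obtain ⟨d', hd', hdd'⟩ := hd i j
      obtain ⟨f, hf0, hf, hf1⟩ := ih d' hd'
      refine ⟨fun c e b => ξ (lit i j) * f c e b, fun c e b => mul_nonneg (hξ _).1 (hf0 c e b),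
        fun c => ?_, fun e => ?_⟩
      · rw [show d (some (i, j, c)) = ξ (lit i j) * d' c from (congrFun hdd' c).symm]
        exact (hf c).mul_left _
      · simp only [← mul_add, ← Finset.mul_sum]
        exact mul_le_of_le_one_right (hξ _).1 (hf1 e)
    choose f hf0 hf hf1 using hcopy
    refine ⟨fun c e b => Option.elim c (if b then β e.1 else 0)
      fun x => if x.1 = e.1 ∧ x.2.1 = e.2.1 then f e.1 e.2.1 x.2.2 e.2.2 b else 0, ?_, ?_, ?_⟩
    · rintro (_ | x) e b
      · dsimp only [Option.elim]
        split_ifs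
        exacts [hβ0 _, le_rfl]
      · dsimp only [Option.elim]
        split_ifs
        exacts [hf0 _ _ _ _ _, le_rfl]
    · rintro (_ | ⟨i, j, c⟩) p
      · rw [sum_gapEdg_succ]
        have h (i : Fin m) (j : Fin 3) :=
          sum_gap_potential_diff m n fun v => p (gapEmb m n i j v)
        simp only [Option.elim, if_true, Bool.false_eq_true, if_false, sub_zero, gapSrcE, gapDstE,
          ← Finset.mul_sum, h, sum_gapEmb_telescope, gapSrcC, gapDstC]
        rw [← Finset.sum_mul, hβsum]
        field_simp
      · rw [sum_gapEdg_succ, Finset.sum_eq_single i, Finset.sum_eq_single j]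
        · simpa [gapSrcE, gapDstE, gapSrcC, gapDstC] using hf i j c fun v => p (gapEmb m n i j v)
        · intro j' _ hj
          simp [hj.symm]
        · simp
        · intro i' _ hi
          simp [hi.symm]
        · simp
    · rintro ⟨i, j, e⟩
      rw [sum_gapCom_succ, Finset.sum_eq_single i, Finset.sum_eq_single j]
      · simpa using (add_le_add_right (hf1 i j e) (β i)).trans (by linarith [hβ i j])
      · intro j' _ hj
        simp [hj]
      · simp
      · intro i' _ hi
        simp [hi]
      · simp

theorem one_mem_Uset (hm : 0 < m)
    (hval : ∀ a : Fin r → Bool,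
      ((Finset.univ.filter fun i => ∃ j, a (lit i j).1 = (lit i j).2).card : ℝ) ≤ ρ * m)
    (n : ℕ) :
    (fun _ => (1 : ℝ)) ∈ Uset (gapSrcE m n) (gapDstE m n) (gapSrcC m n) (gapDstC m n)
      (GapD m r ρ lit n) := by
  refine ⟨fun _ => zero_le_one, fun d hd => ?_⟩
  obtain ⟨f, hf0, hf, hf1⟩ := exists_unit_routing hm hval n d hd
  exact routable_of_isFlow (gapSrcC_ne_gapDstC m n) hf0 hf hf1

end Routing

/-- **Gap construction, recursive case (Lemma 2 of the paper).**
For `γ ≥ 1` and a 3-CNF formula with `m ≥ 2` clauses, the instance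
`(G_γ, H_γ, D_γ)` (encoded at level `γ - 1`) has exactly
`2 + 2m((3m)^γ - 1)/(3m - 1)` vertices and maximum degree `m^γ`, and with unit
capacity on every edge:
(a) if the formula is satisfiable then every feasible reservation for `D_γ` has
congestion at least `1 + γ(1 - ρ)`;
(b) if every truth assignment satisfies fewer than `ρ·m` clauses then the
all-ones reservation is feasible, i.e. the minimum congestion is at most `1`. -/
theorem gap_reduction_recursive
    (ρ : ℝ) (hρ0 : 0 < ρ) (hρ1 : ρ < 1)
    (m r : ℕ) (hm : 2 ≤ m) (lit : Fin m → Fin 3 → Fin r × Bool)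
    (γ : ℕ) (hγ : 1 ≤ γ) :
    Fintype.card (GapVtx m (γ - 1)) = 2 + 2 * m * (((3 * m) ^ γ - 1) / (3 * m - 1)) ∧
    Finset.univ.sup (gapDegree m (γ - 1)) = m ^ γ ∧
    ((∃ a : Fin r → Bool, ∀ i : Fin m, ∃ j : Fin 3, a (lit i j).1 = (lit i j).2) →
      ∀ u ∈ Uset (gapSrcE m (γ - 1)) (gapDstE m (γ - 1)) (gapSrcC m (γ - 1))
          (gapDstC m (γ - 1)) (GapD m r ρ lit (γ - 1)),
        1 + (γ : ℝ) * (1 - ρ) ≤ ⨆ e : GapEdg m (γ - 1), u e / 1) ∧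
    ((∀ a : Fin r → Bool,
        ((Finset.univ.filter
          (fun i : Fin m => ∃ j : Fin 3, a (lit i j).1 = (lit i j).2)).card : ℝ)
          < ρ * m) →
      (fun _ : GapEdg m (γ - 1) => (1 : ℝ)) ∈
        Uset (gapSrcE m (γ - 1)) (gapDstE m (γ - 1)) (gapSrcC m (γ - 1))
          (gapDstC m (γ - 1)) (GapD m r ρ lit (γ - 1))) := by
  obtain ⟨n, rfl⟩ : ∃ n, γ = n + 1 := ⟨γ - 1, by omega⟩
  rw [Nat.add_sub_cancel]
  refine ⟨?_, sup_gapDegree hm n, ?_, fun h => ?_⟩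
  · rw [card_gapVtx, card_gapInner, Nat.geomSum_eq (by omega)]
  · rintro ⟨a, ha⟩ u hu
    simp only [div_one]
    exact le_iSup_of_mem_Uset hρ1.le (by omega) ha n hu
  · exact one_mem_Uset (by omega) (fun a => (h a).le) n
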